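/- arXiv:2204.04108 — 2 statements merged into one kernel-verified Lean document; each statement's English description precedes it below -/
import Mathlib

section
/- Let d ≥ 2 be an integer and 0 < α < 1 a real number. Let X be a finite subset of the unit sphere S^{d−1} in ℝ^d such that for all distinct x, y ∈ X, the inner product ⟨x, y⟩ lies in {α, −α, 0}. If (d+6)(d+8)α⁴ − 15(d+6)α² + 45 ≤ 0 and (d+4)(d+8)α⁴ − 15(d+4)α² + 30 < 0, then |X| ≤ d(d+4)·(1−α²)·(15 − (d+8)(1+α²)) / ((d+4)(d+8)α⁴ − 15(d+4)α² + 30). -/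
open Finset

/-- The Euclidean inner product on `ℝ^d`. -/
def dotR {d : ℕ} (x y : Fin d → ℝ) : ℝ := ∑ i, x i * y i

open MvPolynomial

/-- The Fischer form on real polynomials: monomials are orthogonal and the square norm of `X ^ m`
is `∏ i, (m i)!`. -/
noncomputable def fischer (σ : Type*) [Fintype σ] :
    MvPolynomial σ ℝ →ₗ[ℝ] MvPolynomial σ ℝ →ₗ[ℝ] ℝ :=
  (basisMonomials σ ℝ).constr ℝ fun m => (∏ i, ((m i).factorial : ℝ)) • lcoeff ℝ m

theorem pderiv_ofNat {σ : Type*} (i : σ) (n : ℕ) [n.AtLeastTwo] :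
    pderiv i (ofNat(n) : MvPolynomial σ ℝ) = 0 :=
  (pderiv i).map_natCast n

theorem C_ofNat_real {σ : Type*} (n : ℕ) [n.AtLeastTwo] :
    (C (ofNat(n) : ℝ) : MvPolynomial σ ℝ) = ofNat(n) :=
  map_ofNat C n

section Fischer

variable {σ : Type*} [Fintype σ]

theorem fischer_monomial (m : σ →₀ ℕ) (c : ℝ) (q : MvPolynomial σ ℝ) :
    fischer σ (monomial m c) q = c * ((∏ i, ((m i).factorial : ℝ)) * coeff m q) := by
  have h : monomial m c = c • basisMonomials σ ℝ m := by
    simp [coe_basisMonomials, smul_monomial]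
  rw [h, map_smul, fischer, Module.Basis.constr_basis]
  simp [lcoeff]

theorem fischer_self_nonneg (p : MvPolynomial σ ℝ) : 0 ≤ fischer σ p p := by
  have h : fischer σ p p = ∑ m ∈ p.support, fischer σ (monomial m (coeff m p)) p := by
    rw [← LinearMap.sum_apply, ← map_sum, ← as_sum p]
  rw [h]
  refine Finset.sum_nonneg fun m _ => ?_
  rw [fischer_monomial, mul_left_comm]
  exact mul_nonneg (Finset.prod_nonneg fun i _ => Nat.cast_nonneg _) (mul_self_nonneg _)

theorem fischer_X_mul (i : σ) (p q : MvPolynomial σ ℝ) :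
    fischer σ (X i * p) q = fischer σ p (pderiv i q) := by
  classical
  induction p using MvPolynomial.induction_on' with
  | monomial m c =>
    have hX : X i * monomial m c = monomial (m + Finsupp.single i 1) c := by
      rw [mul_comm, X, monomial_mul, mul_one]
    have hfact : (∏ j, (((m + Finsupp.single i 1 : σ →₀ ℕ) j).factorial : ℝ))
        = (m i + 1) * ∏ j, ((m j).factorial : ℝ) := by
      rw [← Finset.mul_prod_erase _ _ (Finset.mem_univ i),
        ← Finset.mul_prod_erase _ (fun j => ((m j).factorial : ℝ)) (Finset.mem_univ i), ← mul_assoc]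
      congr 1
      · simp [Nat.factorial_succ]
      · refine Finset.prod_congr rfl fun j hj => ?_
        simp [Finsupp.single_eq_of_ne (Finset.ne_of_mem_erase hj)]
    rw [hX, fischer_monomial, fischer_monomial, coeff_pderiv, hfact]
    ring
  | add p p' hp hp' => simp [mul_add, hp, hp']

/-- The linear form `∑ i, x i * X i`. -/
noncomputable def linForm (x : σ → ℝ) : MvPolynomial σ ℝ := ∑ i, C (x i) * X i

/-- The quadratic form `∑ i, X i ^ 2`. -/
noncomputable def normSqPoly (σ : Type*) [Fintype σ] : MvPolynomial σ ℝ := ∑ i, X i ^ 2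

/-- The Laplacian of a polynomial. -/
noncomputable def laplace (p : MvPolynomial σ ℝ) : MvPolynomial σ ℝ :=
  ∑ i, pderiv i (pderiv i p)

theorem fischer_linForm_pow (x : σ → ℝ) (k : ℕ) {q : MvPolynomial σ ℝ} (hq : q.IsHomogeneous k) :
    fischer σ (linForm x ^ k) q = k.factorial * eval x q := by
  induction k generalizing q with
  | zero =>
    obtain ⟨c, rfl⟩ : ∃ c, q = C c := ⟨_, (totalDegree_eq_zero_iff_eq_C).1
      (Nat.le_zero.1 hq.totalDegree_le)⟩
    have h := fischer_monomial (0 : σ →₀ ℕ) 1 (C c)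
    simpa using h
  | succ k ih =>
    have hE := congrArg (eval x) hq.sum_X_mul_pderiv
    simp only [map_sum, map_mul, eval_X, nsmul_eq_mul, map_natCast] at hE
    have h : linForm x ^ (k + 1) = ∑ i, x i • (X i * linForm x ^ k) := by
      rw [pow_succ', linForm, Finset.sum_mul]
      refine Finset.sum_congr rfl fun i _ => ?_
      rw [mul_assoc, C_mul']
    rw [h, map_sum, LinearMap.sum_apply]
    have hi : ∀ i, fischer σ (x i • (X i * linForm x ^ k)) q
        = k.factorial * (x i * eval x (pderiv i q)) := fun i => by
      rw [map_smul, LinearMap.smul_apply, fischer_X_mul, ih hq.pderiv, smul_eq_mul]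
      ring
    rw [Finset.sum_congr rfl fun i _ => hi i, ← Finset.mul_sum, hE, Nat.factorial_succ]
    push_cast
    ring

theorem fischer_normSqPoly_mul (p q : MvPolynomial σ ℝ) :
    fischer σ (normSqPoly σ * p) q = fischer σ p (laplace q) := by
  simp only [normSqPoly, laplace, Finset.sum_mul, map_sum, LinearMap.sum_apply, pow_two, mul_assoc,
    fischer_X_mul]

theorem laplace_sum {ι : Type*} (s : Finset ι) (p : ι → MvPolynomial σ ℝ) :
    laplace (∑ x ∈ s, p x) = ∑ x ∈ s, laplace (p x) := by
  simp only [laplace, map_sum]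
  exact Finset.sum_comm

/-- A kernel whose sections are harmonic and agree with `a * ⟨x, ·⟩ ^ k` modulo the squared norm
is positive semidefinite. -/
theorem sum_sum_eval_nonneg_of_harmonic (s : Finset (σ → ℝ)) {k : ℕ} {a : ℝ}
    (G R : (σ → ℝ) → MvPolynomial σ ℝ)
    (hG : ∀ x ∈ s, G x = a • linForm x ^ k + normSqPoly σ * R x)
    (hhom : ∀ x ∈ s, (G x).IsHomogeneous k) (hharm : ∀ x ∈ s, laplace (G x) = 0) :
    0 ≤ a * ∑ x ∈ s, ∑ y ∈ s, eval x (G y) := by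
  set p := ∑ y ∈ s, G y with hp
  have hp_hom : p.IsHomogeneous k := IsHomogeneous.sum _ _ _ hhom
  have hp_harm : laplace p = 0 := by rw [hp, laplace_sum, Finset.sum_eq_zero hharm]
  have hsec : ∀ x ∈ s, fischer σ (G x) p = k.factorial * (a * ∑ y ∈ s, eval x (G y)) := by
    intro x hx
    rw [hG x hx, map_add, LinearMap.add_apply, fischer_normSqPoly_mul, hp_harm, map_zero, map_smul,
      LinearMap.smul_apply, fischer_linForm_pow x k hp_hom, hp, map_sum, smul_eq_mul]
    ring
  have hpp : fischer σ p p = k.factorial * (a * ∑ x ∈ s, ∑ y ∈ s, eval x (G y)) := by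
    have hsum : fischer σ p p = ∑ x ∈ s, fischer σ (G x) p := by
      rw [← LinearMap.sum_apply, ← map_sum]
    rw [hsum, Finset.sum_congr rfl hsec, Finset.mul_sum, Finset.mul_sum]
  have hk : (0 : ℝ) < k.factorial := by exact_mod_cast k.factorial_pos
  exact nonneg_of_mul_nonneg_right (hpp ▸ fischer_self_nonneg p) hk

theorem isHomogeneous_linForm (x : σ → ℝ) : (linForm x).IsHomogeneous 1 :=
  IsHomogeneous.sum _ _ _ fun i _ => by
    simpa using (isHomogeneous_C σ (x i)).mul (isHomogeneous_X ℝ i)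

theorem isHomogeneous_normSqPoly : (normSqPoly σ).IsHomogeneous 2 :=
  IsHomogeneous.sum _ _ _ fun i _ => isHomogeneous_X_pow i 2

theorem pderiv_linForm (x : σ → ℝ) (i : σ) : pderiv i (linForm x) = C (x i) := by
  classical
  simp [linForm, pderiv_X, Pi.single_apply]

theorem pderiv_normSqPoly (i : σ) : pderiv i (normSqPoly σ) = 2 * X i := by
  classical
  simp [normSqPoly, pderiv_X, Pi.single_apply]

theorem sum_C_sq_eq_one {x : σ → ℝ} (hx : ∑ i, x i * x i = 1) :
    ∑ i, (C (x i) : MvPolynomial σ ℝ) ^ 2 = 1 := by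
  rw [← C_1, ← hx, map_sum]
  exact Finset.sum_congr rfl fun i _ => by rw [pow_two, C_mul]

theorem isHomogeneous_C_mul_linForm_pow_mul_normSqPoly_pow (c : ℝ) (x : σ → ℝ) (a b : ℕ) :
    (C c * (linForm x ^ a * normSqPoly σ ^ b)).IsHomogeneous (a + 2 * b) := by
  have h := (isHomogeneous_C σ c).mul
    (((isHomogeneous_linForm x).pow a).mul (isHomogeneous_normSqPoly.pow b))
  convert h using 1
  ring

end Fischer

section Gegenbauer

variable {d : ℕ}

theorem eval_linForm (x y : Fin d → ℝ) : eval x (linForm y) = dotR x y := by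
  simp [linForm, dotR, mul_comm]

theorem eval_normSqPoly (x : Fin d → ℝ) : eval x (normSqPoly (Fin d)) = dotR x x := by
  simp [normSqPoly, dotR, pow_two]

theorem sum_sum_gegenbauer_two_nonneg (s : Finset (Fin d → ℝ)) (hs : ∀ x ∈ s, dotR x x = 1) :
    0 ≤ ∑ x ∈ s, ∑ y ∈ s, ((d : ℝ) * dotR x y ^ 2 - 1) := by
  rcases Nat.eq_zero_or_pos d with rfl | hd
  · rcases s.eq_empty_or_nonempty with rfl | ⟨x, hx⟩
    · simp
    · simpa [dotR] using hs x hx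
  set G : (Fin d → ℝ) → MvPolynomial (Fin d) ℝ := fun x =>
    C (d : ℝ) * (linForm x ^ 2 * normSqPoly (Fin d) ^ 0)
      + C (-1) * (linForm x ^ 0 * normSqPoly (Fin d) ^ 1) with hGdef
  have hd0 : (0 : ℝ) < d := by exact_mod_cast hd
  have key := sum_sum_eval_nonneg_of_harmonic s (k := 2) (a := d) G (fun _ => C (-1))
    (fun x _ => by simp only [hGdef, ← C_mul']; ring)
    (fun x _ => (isHomogeneous_C_mul_linForm_pow_mul_normSqPoly_pow _ x 2 0).add
      (isHomogeneous_C_mul_linForm_pow_mul_normSqPoly_pow _ x 0 1))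
    (fun x hx => by
      have hi : ∀ i, pderiv i (pderiv i (G x)) = 2 * (d : MvPolynomial (Fin d) ℝ) * C (x i) ^ 2
          - 2 * 1 := fun i => by
        simp [hGdef, pderiv_linForm, pderiv_normSqPoly, pderiv_ofNat]
        ring
      simp only [laplace, hi, Finset.sum_sub_distrib, ← Finset.mul_sum, sum_C_sq_eq_one (hs x hx)]
      simp [mul_comm])
  refine (nonneg_of_mul_nonneg_right key hd0).trans_eq ?_
  refine Finset.sum_congr rfl fun x hx => Finset.sum_congr rfl fun y _ => ?_
  simp [hGdef, eval_linForm, eval_normSqPoly, hs x hx]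
  ring

theorem sum_sum_gegenbauer_six_nonneg (s : Finset (Fin d → ℝ)) (hs : ∀ x ∈ s, dotR x x = 1) :
    0 ≤ ∑ x ∈ s, ∑ y ∈ s, (((d : ℝ) + 4) * (d + 6) * (d + 8) * dotR x y ^ 6
      - 15 * (d + 4) * (d + 6) * dotR x y ^ 4 + 45 * (d + 4) * dotR x y ^ 2 - 15) := by
  set a : ℝ := ((d : ℝ) + 4) * (d + 6) * (d + 8) with ha
  set N := normSqPoly (Fin d) with hN
  set G : (Fin d → ℝ) → MvPolynomial (Fin d) ℝ := fun x =>
    C a * (linForm x ^ 6 * N ^ 0) + C (-(15 * ((d : ℝ) + 4) * (d + 6))) * (linForm x ^ 4 * N ^ 1)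
      + C (45 * ((d : ℝ) + 4)) * (linForm x ^ 2 * N ^ 2) + C (-15) * (linForm x ^ 0 * N ^ 3) with hGdef
  have ha0 : 0 < a := by positivity
  have key := sum_sum_eval_nonneg_of_harmonic s (k := 6) (a := a) G
    (fun x => C (-(15 * ((d : ℝ) + 4) * (d + 6))) * linForm x ^ 4
      + C (45 * ((d : ℝ) + 4)) * (linForm x ^ 2 * N) + C (-15) * N ^ 2)
    (fun x _ => by simp only [hGdef, ← C_mul']; ring)
    (fun x _ => (((isHomogeneous_C_mul_linForm_pow_mul_normSqPoly_pow _ x 6 0).add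
      (isHomogeneous_C_mul_linForm_pow_mul_normSqPoly_pow _ x 4 1)).add
      (isHomogeneous_C_mul_linForm_pow_mul_normSqPoly_pow _ x 2 2)).add
      (isHomogeneous_C_mul_linForm_pow_mul_normSqPoly_pow _ x 0 3))
    (fun x hx => by
      set L := linForm x with hL
      set D : MvPolynomial (Fin d) ℝ := (d : MvPolynomial (Fin d) ℝ) with hD
      have hi : ∀ i, pderiv i (pderiv i (G x)) =
          (30 * (D + 4) * (D + 6) * (D + 8) * L ^ 4 - 180 * (D + 4) * (D + 6) * L ^ 2 * N
            + 90 * (D + 4) * N ^ 2) * C (x i) ^ 2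
          + (-(240 * (D + 4) * (D + 6)) * L ^ 3 + 720 * (D + 4) * L * N) * (C (x i) * X i)
          + (360 * (D + 4) * L ^ 2 - 360 * N) * X i ^ 2
          + (-(30 * (D + 4) * (D + 6)) * L ^ 4 + 180 * (D + 4) * L ^ 2 * N - 90 * N ^ 2) * 1 :=
        fun i => by
          simp [hGdef, ha, hN, hL, hD, pderiv_linForm, pderiv_normSqPoly,
            pderiv_ofNat, C_ofNat_real]
          ring
      have hsumL : ∑ i, C (x i) * X i = L := rfl
      have hsumN : ∑ i, X i ^ 2 = N := rfl
      simp only [laplace, hi, Finset.sum_add_distrib, ← Finset.mul_sum,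
        sum_C_sq_eq_one (hs x hx), hsumL, hsumN, Finset.sum_const, Finset.card_univ,
        Fintype.card_fin, nsmul_eq_mul, ← hD]
      ring)
  refine (nonneg_of_mul_nonneg_right key ha0).trans_eq ?_
  refine Finset.sum_congr rfl fun x hx => Finset.sum_congr rfl fun y _ => ?_
  simp [hGdef, hN, eval_linForm, eval_normSqPoly, hs x hx]
  ring

end Gegenbauer

theorem three_distance_bound_Hadamard2 (d : ℕ) (hd : 2 ≤ d) (α : ℝ)
    (hα0 : 0 < α) (hα1 : α < 1) (X : Finset (Fin d → ℝ))
    (hX : ∀ x ∈ X, dotR x x = 1)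
    (hA : ∀ x ∈ X, ∀ y ∈ X, x ≠ y →
      dotR x y = α ∨ dotR x y = -α ∨ dotR x y = 0)
    (h1 : ((d : ℝ) + 6) * ((d : ℝ) + 8) * α ^ 4 - 15 * ((d : ℝ) + 6) * α ^ 2 + 45 ≤ 0)
    (h2 : ((d : ℝ) + 4) * ((d : ℝ) + 8) * α ^ 4 - 15 * ((d : ℝ) + 4) * α ^ 2 + 30 < 0) :
    (X.card : ℝ) ≤ (d : ℝ) * ((d : ℝ) + 4) * (1 - α ^ 2) *
        (15 - ((d : ℝ) + 8) * (1 + α ^ 2)) /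
      (((d : ℝ) + 4) * ((d : ℝ) + 8) * α ^ 4 - 15 * ((d : ℝ) + 4) * α ^ 2 + 30) := by
  have hd2 : (2 : ℝ) ≤ d := by exact_mod_cast hd
  set D : ℝ := (d : ℝ) with hD
  set n : ℝ := (X.card : ℝ) with hn
  set h : ℝ := (D + 6) * (D + 8) * α ^ 4 - 15 * (D + 6) * α ^ 2 + 45 with hh
  set δ : ℝ := (D + 4) * (D + 8) * α ^ 4 - 15 * (D + 4) * α ^ 2 + 30 with hδ
  -- the polynomial vanishing at `0` and `±α`, whose degree four Gegenbauer coefficient is zero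
  set F : ℝ → ℝ := fun t => D * (D + 4) * (D + 6) *
    (t ^ 2 * (t ^ 2 - α ^ 2) * ((D + 8) * (t ^ 2 + α ^ 2) - 15)) with hF
  have hexp : ∀ t, F t = D * ((D + 4) * (D + 6) * (D + 8) * t ^ 6 - 15 * (D + 4) * (D + 6) * t ^ 4
      + 45 * (D + 4) * t ^ 2 - 15) + -((D + 4) * h) * (D * t ^ 2 - 1) + -((D + 6) * δ) := by
    intro t
    simp only [hF, hh, hδ]
    ring
  have hlow : n * (n * -((D + 6) * δ)) ≤ ∑ x ∈ X, ∑ y ∈ X, F (dotR x y) := by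
    have g2 := sum_sum_gegenbauer_two_nonneg X hX
    have g6 := sum_sum_gegenbauer_six_nonneg X hX
    rw [← hD] at g2 g6
    have hc : 0 ≤ -((D + 4) * h) := by nlinarith
    have t2 := mul_nonneg hc g2
    have t6 := mul_nonneg (by linarith : 0 ≤ D) g6
    simp only [hexp, Finset.sum_add_distrib, ← Finset.mul_sum, Finset.sum_const, nsmul_eq_mul,
      ← hn]
    linarith
  have hdiag : ∑ x ∈ X, ∑ y ∈ X, F (dotR x y) = n * F 1 := by
    have hx : ∀ x ∈ X, ∑ y ∈ X, F (dotR x y) = F 1 := fun x hx => by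
      rw [Finset.sum_eq_single_of_mem x hx, hX x hx]
      intro y hy hyx
      rcases hA x hx y hy hyx.symm with e | e | e <;> simp [hF, e]
    rw [Finset.sum_congr rfl hx, Finset.sum_const, nsmul_eq_mul]
  rw [hdiag] at hlow
  have hF1 : 0 ≤ F 1 := by
    have e : F 1 = D * ((D - 1) * (D + 1) * (D + 3)) + (D + 4) * (D - 1) * -h + (D + 6) * -δ := by
      rw [hexp]
      ring
    rw [e]
    have : 0 ≤ D - 1 := by linarith
    have : 0 ≤ -h := by linarith
    have : 0 ≤ -δ := by linarith
    positivity
  rw [← neg_div_neg_eq, le_div_iff₀ (by linarith)]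
  have hmain : n * -((D + 6) * δ) ≤ F 1 := by
    rcases (Nat.cast_nonneg X.card : (0 : ℝ) ≤ n).eq_or_lt with h0 | h0
    · rw [show n = 0 from h0.symm, zero_mul]
      exact hF1
    · exact le_of_mul_le_mul_left hlow h0
  have hpos : 0 < D + 6 := by linarith
  refine le_of_mul_le_mul_left ?_ hpos
  calc (D + 6) * (n * -δ) = n * -((D + 6) * δ) := by ring
    _ ≤ F 1 := hmain
    _ = _ := by
      simp only [hF]
      ring
end

section
/- Let α ∈ (−1, 0) and β ∈ (0, 1) be real numbers with α + β > 0, and let d ≥ 2 be an integer with d = −1/(αβ). Let X be a finite subset of the unit sphere S^{d−1} in ℝ^d such that for all distinct x, y ∈ X, the inner product ⟨x, y⟩ lies in {α, β, αβ}. If (α+β+1)(1−2αβ) ≤ 3, and (α²+αβ+β²+α+β−1)(−8α³β³+6α²β²+11αβ) ≥ (4α³β³+3α²β²+5αβ) + 9αβ(α+β) + 3(α²+β²), and (α²+2αβ+β²+α+β+1)(4α²β²−8αβ) < −6αβ(α+β+3) − 3(α²+β²), then |X| ≤ 2(1−α²)(1−β²)(1−αβ)(1−2αβ) / (αβ·((α²+2αβ+β²+α+β+1)(4α²β²−8αβ)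 + 6αβ(α+β+3) + 3(α²+β²))). -/
open Finset

namespace GegenbauerKernel

/-- A kernel given by inner products of feature vectors is positive on finite sets. -/
lemma sum_sum_nonneg_of_feature {E ι : Type*} [Fintype ι] (X : Finset E) (φ : E → ι → ℝ)
    (K : E → E → ℝ) (hK : ∀ x ∈ X, ∀ y ∈ X, K x y = ∑ q, φ x q * φ y q) :
    0 ≤ ∑ x ∈ X, ∑ y ∈ X, K x y := by
  have h : ∑ x ∈ X, ∑ y ∈ X, K x y = ∑ q, (∑ x ∈ X, φ x q) ^ 2 := by
    calc ∑ x ∈ X, ∑ y ∈ X, K x y = ∑ x ∈ X, ∑ y ∈ X, ∑ q, φ x q * φ y q :=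
          sum_congr rfl fun x hx => sum_congr rfl fun y hy => hK x hx y hy
      _ = ∑ x ∈ X, ∑ q, ∑ y ∈ X, φ x q * φ y q := sum_congr rfl fun x _ => sum_comm
      _ = ∑ q, ∑ x ∈ X, ∑ y ∈ X, φ x q * φ y q := sum_comm
      _ = ∑ q, (∑ x ∈ X, φ x q) ^ 2 := by simp only [sq, sum_mul_sum]
  rw [h]
  positivity

variable {d : ℕ}

/-- The Kronecker delta. -/
def delta (i j : Fin d) : ℝ := if i = j then 1 else 0

/-- The sum of the three products of `δ` with a vector, over all placements of the indices. -/
def symDelta3 (v : Fin d → ℝ) (i j k : Fin d) : ℝ :=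
  delta i j * v k + delta i k * v j + delta j k * v i

/-- The sum of the six products of `δ` with a matrix, over all placements of the indices. -/
def symDelta4 (A : Fin d → Fin d → ℝ) (i j k l : Fin d) : ℝ :=
  delta i j * A k l + delta i k * A j l + delta i l * A j k +
    delta j k * A i l + delta j l * A i k + delta k l * A i j

lemma sum_symDelta3_mul (v : Fin d → ℝ) (T : Fin d → Fin d → Fin d → ℝ)
    (h12 : ∀ i j k, T i j k = T j i k) (h23 : ∀ i j k, T i j k = T i k j) :
    ∑ i, ∑ j, ∑ k, symDelta3 v i j k * T i j k = 3 * ∑ k, v k * ∑ i, T i i k := by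
  have e1 : ∑ i, ∑ j, ∑ k, delta i j * v k * T i j k = ∑ k, v k * ∑ i, T i i k := by
    simp only [delta, ite_mul, one_mul, zero_mul, mul_sum]
    rw [sum_comm]
    simp only [sum_ite_irrel, sum_const_zero, sum_ite_eq', mem_univ, if_true]
    rw [sum_comm]
  have e2 : ∑ i, ∑ j, ∑ k, delta i k * v j * T i j k = ∑ k, v k * ∑ i, T i i k := by
    simp only [delta, ite_mul, one_mul, zero_mul, mul_sum, sum_ite_eq, mem_univ, if_true]
    rw [sum_comm]
    exact sum_congr rfl fun j _ => sum_congr rfl fun i _ => by rw [h23]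
  have e3 : ∑ i, ∑ j, ∑ k, delta j k * v i * T i j k = ∑ k, v k * ∑ i, T i i k := by
    simp only [delta, ite_mul, one_mul, zero_mul, mul_sum, sum_ite_eq, mem_univ, if_true]
    exact sum_congr rfl fun i _ => sum_congr rfl fun j _ => by rw [h12, h23]
  simp only [symDelta3, add_mul, sum_add_distrib, e1, e2, e3]
  ring

lemma sum_symDelta4_mul (A : Fin d → Fin d → ℝ) (T : Fin d → Fin d → Fin d → Fin d → ℝ)
    (h12 : ∀ i j k l, T i j k l = T j i k l) (h23 : ∀ i j k l, T i j k l = T i k j l)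
    (h34 : ∀ i j k l, T i j k l = T i j l k) :
    ∑ i, ∑ j, ∑ k, ∑ l, symDelta4 A i j k l * T i j k l =
      6 * ∑ k, ∑ l, A k l * ∑ i, T i i k l := by
  have e1 : ∑ i, ∑ j, ∑ k, ∑ l, delta i j * A k l * T i j k l =
      ∑ i, ∑ k, ∑ l, A k l * T i i k l := by
    simp only [delta, ite_mul, one_mul, zero_mul, sum_ite_irrel, sum_const_zero, sum_ite_eq,
      mem_univ, if_true]
  have e2 : ∑ i, ∑ j, ∑ k, ∑ l, delta i k * A j l * T i j k l =
      ∑ i, ∑ k, ∑ l, A k l * T i i k l := by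
    simp only [delta, ite_mul, one_mul, zero_mul, sum_ite_irrel, sum_const_zero, sum_ite_eq,
      mem_univ, if_true]
    refine sum_congr rfl fun i _ => sum_congr rfl fun j _ => sum_congr rfl fun l _ => ?_
    rw [h23]
  have e3 : ∑ i, ∑ j, ∑ k, ∑ l, delta i l * A j k * T i j k l =
      ∑ i, ∑ k, ∑ l, A k l * T i i k l := by
    simp only [delta, ite_mul, one_mul, zero_mul, sum_ite_eq, mem_univ, if_true]
    refine sum_congr rfl fun i _ => sum_congr rfl fun j _ => sum_congr rfl fun k _ => ?_
    rw [h34, h23]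
  have e4 : ∑ i, ∑ j, ∑ k, ∑ l, delta j k * A i l * T i j k l =
      ∑ i, ∑ k, ∑ l, A k l * T i i k l := by
    simp only [delta, ite_mul, one_mul, zero_mul, sum_ite_irrel, sum_const_zero, sum_ite_eq,
      mem_univ, if_true]
    rw [sum_comm]
    refine sum_congr rfl fun j _ => sum_congr rfl fun i _ => sum_congr rfl fun l _ => ?_
    rw [h12, h23]
  have e5 : ∑ i, ∑ j, ∑ k, ∑ l, delta j l * A i k * T i j k l =
      ∑ i, ∑ k, ∑ l, A k l * T i i k l := by
    simp only [delta, ite_mul, one_mul, zero_mul, sum_ite_eq, mem_univ, if_true]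
    rw [sum_comm]
    refine sum_congr rfl fun j _ => sum_congr rfl fun i _ => sum_congr rfl fun k _ => ?_
    rw [h34, h12, h23]
  have e6 : ∑ i, ∑ j, ∑ k, ∑ l, delta k l * A i j * T i j k l =
      ∑ i, ∑ k, ∑ l, A k l * T i i k l := by
    simp only [delta, ite_mul, one_mul, zero_mul, sum_ite_eq, mem_univ, if_true]
    rw [sum_comm' (t' := univ) (s' := fun _ => univ) (by simp)]
    rw [sum_congr rfl fun j _ => sum_comm, sum_comm]
    refine sum_congr rfl fun k _ => ?_
    rw [sum_comm]
    refine sum_congr rfl fun i _ => sum_congr rfl fun j _ => ?_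
    rw [h23, h12, h34, h23]
  have e : ∑ k, ∑ l, A k l * ∑ i, T i i k l = ∑ i, ∑ k, ∑ l, A k l * T i i k l := by
    simp only [mul_sum]
    rw [sum_congr rfl fun k _ => sum_comm, sum_comm]
  simp only [symDelta4, add_mul, sum_add_distrib, e1, e2, e3, e4, e5, e6, e]
  ring

lemma delta_comm (i j : Fin d) : delta i j = delta j i := by
  simp only [delta, eq_comm]

lemma sum_delta_mul (i : Fin d) (f : Fin d → ℝ) : ∑ j, delta i j * f j = f i := by
  simp [delta]

lemma sum_delta_self : ∑ i : Fin d, delta i i = (d : ℝ) := by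
  simp [delta]

/-- The second Gegenbauer polynomial is a positive kernel on the unit sphere. -/
lemma sum_gegenbauer_two_nonneg {v : ℝ} (hv : (d : ℝ) * v = 1) (X : Finset (Fin d → ℝ))
    (hX : ∀ x ∈ X, dotR x x = 1) :
    0 ≤ ∑ x ∈ X, ∑ y ∈ X, (dotR x y ^ 2 - v) := by
  refine sum_sum_nonneg_of_feature X
    (fun x (q : Fin d × Fin d) => x q.1 * x q.2 - v * delta q.1 q.2) _ fun x hx y hy => ?_
  have e (i j : Fin d) : (x i * x j - v * delta i j) * (y i * y j - v * delta i j) =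
      (x i * y i) * (x j * y j) - v * (delta i j * (x i * x j)) - v * (delta i j * (y i * y j)) +
        v ^ 2 * (delta i j * delta i j) := by ring
  have hx' := hX x hx
  have hy' := hX y hy
  rw [Fintype.sum_prod_type]
  simp only [e, sum_add_distrib, sum_sub_distrib, ← mul_sum, sum_delta_mul, sum_delta_self,
    ← sum_mul]
  unfold dotR at *
  rw [hx', hy']
  linear_combination (-v) * hv

/-- The third Gegenbauer polynomial is a positive kernel on the unit sphere. -/
lemma sum_gegenbauer_three_nonneg {u : ℝ} (hu : ((d : ℝ) + 2) * u = 1) (X : Finset (Fin d → ℝ))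
    (hX : ∀ x ∈ X, dotR x x = 1) :
    0 ≤ ∑ x ∈ X, ∑ y ∈ X, (dotR x y ^ 3 - 3 * u * dotR x y) := by
  set φ : (Fin d → ℝ) → Fin d → Fin d → Fin d → ℝ :=
    fun x i j k => x i * x j * x k - u * symDelta3 x i j k with hφ
  refine sum_sum_nonneg_of_feature X
    (fun x (q : Fin d × Fin d × Fin d) => φ x q.1 q.2.1 q.2.2) _ fun x hx y hy => ?_
  have hy' := hX y hy
  have hx' := hX x hx
  have traceless (k : Fin d) : ∑ i, φ y i i k = 0 := by
    have e (i : Fin d) : φ y i i k =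
        (y i * y i) * y k - u * y k * delta i i - 2 * u * (delta k i * y i) := by
      simp only [hφ, symDelta3, delta_comm i k]; ring
    simp only [e, sum_sub_distrib, ← mul_sum, ← sum_mul, sum_delta_mul, sum_delta_self]
    unfold dotR at hy'
    rw [hy']
    linear_combination (-y k) * hu
  have hS : ∑ i, ∑ j, ∑ k, symDelta3 x i j k * φ y i j k = 0 := by
    rw [sum_symDelta3_mul]
    · simp [traceless]
    · intro i j k; simp only [hφ, symDelta3, delta_comm j i]; ring
    · intro i j k; simp only [hφ, symDelta3, delta_comm k j]; ring
  have hM : ∑ i, ∑ j, ∑ k, symDelta3 y i j k * (x i * x j * x k) = 3 * dotR x y := by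
    rw [sum_symDelta3_mul _ (fun i j k => x i * x j * x k)
      (fun i j k => by ring) (fun i j k => by ring)]
    simp only [← sum_mul]
    unfold dotR at hx' ⊢
    rw [hx']
    congr 1
    exact sum_congr rfl fun i _ => by ring
  have hP : ∑ i, ∑ j, ∑ k, (x i * y i) * (x j * y j) * (x k * y k) = dotR x y ^ 3 := by
    simp only [← mul_sum, ← sum_mul]
    unfold dotR; ring
  have e (i j k : Fin d) : φ x i j k * φ y i j k =
      (x i * y i) * (x j * y j) * (x k * y k) - u * (symDelta3 y i j k * (x i * x j * x k)) -
        u * (symDelta3 x i j k * φ y i j k) := by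
    simp only [hφ]; ring
  simp only [Fintype.sum_prod_type, e, sum_sub_distrib]
  rw [hP]
  simp only [← mul_sum, hM, hS]
  ring

/-- The fourth Gegenbauer polynomial is a positive kernel on the unit sphere. -/
lemma sum_gegenbauer_four_nonneg {u w : ℝ} (hu : ((d : ℝ) + 2) * u = 1)
    (hw : ((d : ℝ) + 4) * w = 1) (X : Finset (Fin d → ℝ)) (hX : ∀ x ∈ X, dotR x x = 1) :
    0 ≤ ∑ x ∈ X, ∑ y ∈ X, (dotR x y ^ 4 - 6 * w * dotR x y ^ 2 + 3 * u * w) := by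
  set A : (Fin d → ℝ) → Fin d → Fin d → ℝ := fun x k l => x k * x l - u / 2 * delta k l with hA
  set φ : (Fin d → ℝ) → Fin d → Fin d → Fin d → Fin d → ℝ :=
    fun x i j k l => x i * x j * x k * x l - w * symDelta4 (A x) i j k l with hφ
  refine sum_sum_nonneg_of_feature X
    (fun x (q : Fin d × Fin d × Fin d × Fin d) => φ x q.1 q.2.1 q.2.2.1 q.2.2.2) _
    fun x hx y hy => ?_
  have hy' := hX y hy
  have hx' := hX x hx
  have A_comm (k l : Fin d) : A y k l = A y l k := by
    simp only [hA, delta_comm l k]; ring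
  have traceless (k l : Fin d) : ∑ i, φ y i i k l = 0 := by
    have e (i : Fin d) : φ y i i k l =
        (y i * y i) * (y k * y l) - w * A y k l * delta i i - 2 * w * (delta k i * A y i l) -
          2 * w * (delta l i * A y i k) - w * delta k l * (y i * y i) +
            w * delta k l * (u / 2) * delta i i := by
      simp only [hφ, symDelta4, delta_comm i k, delta_comm i l]
      simp only [hA]
      ring
    simp only [e, sum_add_distrib, sum_sub_distrib, ← mul_sum, ← sum_mul, sum_delta_mul,
      sum_delta_self]
    unfold dotR at hy'
    rw [hy', A_comm l k]
    simp only [hA]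
    linear_combination (-(y k * y l)) * hw + w * delta k l * hu
  have hS : ∑ i, ∑ j, ∑ k, ∑ l, symDelta4 (A x) i j k l * φ y i j k l = 0 := by
    rw [sum_symDelta4_mul]
    · simp [traceless]
    · intro i j k l; simp only [hφ, symDelta4, delta_comm j i, A_comm j i]; ring
    · intro i j k l; simp only [hφ, symDelta4, delta_comm k j, A_comm k j]; ring
    · intro i j k l; simp only [hφ, symDelta4, delta_comm l k, A_comm l k]; ring
  have hM : ∑ i, ∑ j, ∑ k, ∑ l, symDelta4 (A y) i j k l * (x i * x j * x k * x l) =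
      6 * (dotR x y ^ 2 - u / 2) := by
    rw [sum_symDelta4_mul _ (fun i j k l => x i * x j * x k * x l)
      (fun i j k l => by ring) (fun i j k l => by ring) (fun i j k l => by ring)]
    have e (k l : Fin d) : A y k l * ∑ i, x i * x i * x k * x l =
        (x k * y k) * (x l * y l) - u / 2 * (delta k l * (x k * x l)) := by
      simp only [← sum_mul]
      unfold dotR at hx'
      rw [hx']
      simp only [hA]; ring
    simp only [e]
    simp only [sum_sub_distrib, ← mul_sum, ← sum_mul, sum_delta_mul]
    unfold dotR at hx' ⊢
    rw [hx']
    ring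
  have hP : ∑ i, ∑ j, ∑ k, ∑ l, (x i * y i) * (x j * y j) * (x k * y k) * (x l * y l) =
      dotR x y ^ 4 := by
    simp only [← mul_sum, ← sum_mul]
    unfold dotR; ring
  have e (i j k l : Fin d) : φ x i j k l * φ y i j k l =
      (x i * y i) * (x j * y j) * (x k * y k) * (x l * y l) -
        w * (symDelta4 (A y) i j k l * (x i * x j * x k * x l)) -
          w * (symDelta4 (A x) i j k l * φ y i j k l) := by
    simp only [hφ]; ring
  simp only [Fintype.sum_prod_type, e, sum_sub_distrib]
  rw [hP]
  simp only [← mul_sum, hM, hS]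
  ring

end GegenbauerKernel

/-- The Gegenbauer expansion, in dimension `-1 / (α * β)`, of the quartic polynomial that vanishes
at `α`, `β` and `α * β` and has no linear harmonic component. -/
lemma gegenbauer_expansion (α β t : ℝ) (h2 : 1 - 2 * (α * β) ≠ 0) (h4 : 1 - 4 * (α * β) ≠ 0) :
    (t - α) * (t - β) * (t - α * β) * (-((α + β + 1) * (1 - 2 * (α * β)) - 3) * t +
        (3 * (α + β) + 2 * (α * β) + 2 * (α * β) ^ 2)) =
      -((α + β + 1) * (1 - 2 * (α * β)) - 3) *
          (t ^ 4 - 6 * (-(α * β) / (1 - 4 * (α * β))) * t ^ 2 +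
            3 * (-(α * β) / (1 - 2 * (α * β))) * (-(α * β) / (1 - 4 * (α * β)))) +
        (1 - 2 * (α * β)) * (α + β) * ((1 + α) * (1 + β)) *
          (t ^ 3 - 3 * (-(α * β) / (1 - 2 * (α * β))) * t) +
        ((α ^ 2 + α * β + β ^ 2 + α + β - 1) *
            (-8 * α ^ 3 * β ^ 3 + 6 * α ^ 2 * β ^ 2 + 11 * (α * β)) -
          ((4 * α ^ 3 * β ^ 3 + 3 * α ^ 2 * β ^ 2 + 5 * (α * β)) +
            9 * (α * β) * (α + β) + 3 * (α ^ 2 + β ^ 2))) /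
          (1 - 4 * (α * β)) * (t ^ 2 - -(α * β)) +
        (α * β) * (1 + α * β) *
          ((α ^ 2 + 2 * (α * β) + β ^ 2 + α + β + 1) * (4 * α ^ 2 * β ^ 2 - 8 * (α * β)) +
            6 * (α * β) * (α + β + 3) + 3 * (α ^ 2 + β ^ 2)) / (1 - 2 * (α * β)) := by
  generalize ha : 1 - 2 * (α * β) = a at *
  generalize hb : 1 - 4 * (α * β) = b at *
  field_simp
  rw [← ha, ← hb]
  ring

theorem three_distance_bound_Qscheme (α β : ℝ)
    (hα : α ∈ Set.Ioo (-1 : ℝ) 0) (hβ : β ∈ Set.Ioo (0 : ℝ) 1)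
    (hαβ : 0 < α + β) (d : ℕ) (hd : 2 ≤ d) (hdval : (d : ℝ) = -1 / (α * β))
    (X : Finset (Fin d → ℝ))
    (hX : ∀ x ∈ X, dotR x x = 1)
    (hA : ∀ x ∈ X, ∀ y ∈ X, x ≠ y →
      dotR x y = α ∨ dotR x y = β ∨ dotR x y = α * β)
    (h1 : (α + β + 1) * (1 - 2 * (α * β)) ≤ 3)
    (h2 : (α ^ 2 + α * β + β ^ 2 + α + β - 1) *
        (-8 * α ^ 3 * β ^ 3 + 6 * α ^ 2 * β ^ 2 + 11 * (α * β)) ≥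
      (4 * α ^ 3 * β ^ 3 + 3 * α ^ 2 * β ^ 2 + 5 * (α * β)) +
        9 * (α * β) * (α + β) + 3 * (α ^ 2 + β ^ 2))
    (h3 : (α ^ 2 + 2 * (α * β) + β ^ 2 + α + β + 1) *
        (4 * α ^ 2 * β ^ 2 - 8 * (α * β)) <
      -6 * (α * β) * (α + β + 3) - 3 * (α ^ 2 + β ^ 2)) :
    (X.card : ℝ) ≤ 2 * (1 - α ^ 2) * (1 - β ^ 2) * (1 - α * β) * (1 - 2 * (α * β)) /
      ((α * β) * ((α ^ 2 + 2 * (α * β) + β ^ 2 + α + β + 1) *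
          (4 * α ^ 2 * β ^ 2 - 8 * (α * β)) +
        6 * (α * β) * (α + β + 3) + 3 * (α ^ 2 + β ^ 2))) := by
  obtain ⟨hα1, hα0⟩ := hα
  obtain ⟨hβ0, hβ1⟩ := hβ
  have hp : α * β < 0 := mul_neg_of_neg_of_pos hα0 hβ0
  have hdp : (d : ℝ) * (α * β) = -1 := by rw [hdval, div_mul_cancel₀ _ hp.ne]
  have hp1 : 0 < 1 + α * β := by nlinarith only [hα1, hα0, hβ0, hβ1]
  set D := (α + β + 1) * (1 - 2 * (α * β)) - 3 with hD
  set Q := (α ^ 2 + 2 * (α * β) + β ^ 2 + α + β + 1) * (4 * α ^ 2 * β ^ 2 - 8 * (α * β)) +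
    6 * (α * β) * (α + β + 3) + 3 * (α ^ 2 + β ^ 2) with hQ
  have hQ0 : Q < 0 := by linarith only [h3, hQ]
  set H := (α ^ 2 + α * β + β ^ 2 + α + β - 1) *
      (-8 * α ^ 3 * β ^ 3 + 6 * α ^ 2 * β ^ 2 + 11 * (α * β)) -
    ((4 * α ^ 3 * β ^ 3 + 3 * α ^ 2 * β ^ 2 + 5 * (α * β)) +
      9 * (α * β) * (α + β) + 3 * (α ^ 2 + β ^ 2)) with hH
  have hH0 : 0 ≤ H := sub_nonneg.mpr h2
  have h2p : 0 < 1 - 2 * (α * β) := by linarith only [hp]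
  have h4p : 0 < 1 - 4 * (α * β) := by linarith only [hp]
  set u := -(α * β) / (1 - 2 * (α * β)) with hu
  set w := -(α * β) / (1 - 4 * (α * β)) with hw
  have K2 := GegenbauerKernel.sum_gegenbauer_two_nonneg (v := -(α * β)) (by linarith only [hdp]) X hX
  have hu1 : ((d : ℝ) + 2) * u = 1 := by
    rw [hu, mul_div_assoc', div_eq_one_iff_eq h2p.ne']; linarith only [hdp]
  have hw1 : ((d : ℝ) + 4) * w = 1 := by
    rw [hw, mul_div_assoc', div_eq_one_iff_eq h4p.ne']; linarith only [hdp]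
  have K3 := GegenbauerKernel.sum_gegenbauer_three_nonneg hu1 X hX
  have K4 := GegenbauerKernel.sum_gegenbauer_four_nonneg hu1 hw1 X hX
  set F : ℝ → ℝ := fun t => (t - α) * (t - β) * (t - α * β) *
    (-D * t + (3 * (α + β) + 2 * (α * β) + 2 * (α * β) ^ 2)) with hF
  set F₃ := (1 - 2 * (α * β)) * (α + β) * ((1 + α) * (1 + β)) with hF₃
  set F₀ := (α * β) * (1 + α * β) * Q / (1 - 2 * (α * β)) with hF₀
  have hF₃0 : 0 ≤ F₃ := by
    have : 0 < 1 + α := by linarith only [hα1]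
    positivity
  have hpQ : 0 < α * β * Q := mul_pos_of_neg_of_neg hp hQ0
  have expand (t : ℝ) : F t = -D * (t ^ 4 - 6 * w * t ^ 2 + 3 * u * w) +
      F₃ * (t ^ 3 - 3 * u * t) + H / (1 - 4 * (α * β)) * (t ^ 2 - -(α * β)) + F₀ := by
    exact gegenbauer_expansion α β t h2p.ne' h4p.ne'
  clear_value D Q H u w F₃ F₀
  have lower : F₀ * (X.card : ℝ) ^ 2 ≤ ∑ x ∈ X, ∑ y ∈ X, F (dotR x y) := by
    simp only [expand, sum_add_distrib, ← mul_sum] at K2 K3 K4 ⊢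
    have t4 := mul_nonneg (show 0 ≤ -D by linarith only [h1, hD]) K4
    have t3 := mul_nonneg hF₃0 K3
    have t2 := mul_nonneg (div_nonneg hH0 h4p.le) K2
    simp only [sum_const, nsmul_eq_mul] at t2 t3 t4 ⊢
    linarith only [t2, t3, t4]
  have total : ∑ x ∈ X, ∑ y ∈ X, F (dotR x y) = X.card * F 1 := by
    have (x : Fin d → ℝ) (hx : x ∈ X) : ∑ y ∈ X, F (dotR x y) = F 1 := by
      rw [sum_eq_single_of_mem x hx, hX x hx]
      intro y hy hne
      rcases hA x hx y hy hne.symm with h | h | h <;> simp [hF, h]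
    rw [sum_congr rfl this, sum_const, nsmul_eq_mul]
  have hF1 : F 1 = 2 * (1 + α * β) * ((1 - α ^ 2) * (1 - β ^ 2) * (1 - α * β)) := by
    simp only [hF, hD]; ring
  rw [total] at lower
  clear_value F
  rw [le_div_iff₀ hpQ]
  rcases Nat.eq_zero_or_pos X.card with h0 | hpos
  · have : 0 ≤ 1 - α ^ 2 := by nlinarith only [hα1, hα0]
    have : 0 ≤ 1 - β ^ 2 := by nlinarith only [hβ0, hβ1]
    have : 0 ≤ 1 - α * β := by linarith only [hp]
    rw [h0, Nat.cast_zero, zero_mul]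
    positivity
  · have hN : (0 : ℝ) < X.card := by exact_mod_cast hpos
    have key : F₀ * X.card ≤ F 1 := by
      refine le_of_mul_le_mul_left ?_ hN
      linarith only [lower]
    rw [hF1, hF₀, div_mul_eq_mul_div, div_le_iff₀ h2p] at key
    refine le_of_mul_le_mul_left ?_ hp1
    linarith only [key]
end
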